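/- Suppose 𝒜 is essential and the poset of regions PR(𝒜,B) is a lattice. If Z, X, Y are faces of 𝒜 such that X covers Z and Y covers Z in the facial weak order FW(𝒜,B), then X and Y have a least upper bound (join) in FW(𝒜,B). -/

import Mathlib

open scoped RealInnerProductSpace Pointwise

variable {V : Type*} [NormedAddCommGroup V] [InnerProductSpace ℝ V] [FiniteDimensional ℝ V]
  {ι : Type*} [Fintype ι]

/-- The (open) complement of the union of the hyperplanes with chosen normals `e i`. -/
def arrComplement (e : ι → V) : Set V := {v | ∀ i, ⟪e i, v⟫ ≠ 0}

/-- A region of the arrangement: the closure of a connected component of the complement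
of the union of the hyperplanes. -/
def IsRegion (e : ι → V) (R : Set V) : Prop :=
  ∃ x ∈ arrComplement e, R = closure (connectedComponentIn (arrComplement e) x)

/-- The positive closed half-space bounded by the hyperplane with normal `e i`. -/
def posHalf (e : ι → V) (i : ι) : Set V := {v | 0 ≤ ⟪e i, v⟫}

/-- The negative closed half-space bounded by the hyperplane with normal `e i`. -/
def negHalf (e : ι → V) (i : ι) : Set V := {v | ⟪e i, v⟫ ≤ 0}

/-- The separation set of two regions: the (indices of) hyperplanes such that the two
regions lie in opposite closed half-spaces. -/
def sepSet (e : ι → V) (R R' : Set V) : Set ι :=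
  {i | (R ⊆ posHalf e i ∧ R' ⊆ negHalf e i) ∨ (R ⊆ negHalf e i ∧ R' ⊆ posHalf e i)}

/-- The order of the poset of regions `PR(𝒜,B)`. -/
def PRle (e : ι → V) (B R R' : Set V) : Prop := sepSet e B R ⊆ sepSet e B R'

/-- Strict order of the poset of regions. -/
def PRlt (e : ι → V) (B R R' : Set V) : Prop := PRle e B R R' ∧ R ≠ R'

/-- Cover relation in the poset of regions. -/
def PRcover (e : ι → V) (B R R' : Set V) : Prop :=
  PRlt e B R R' ∧ ¬ ∃ U, IsRegion e U ∧ PRlt e B R U ∧ PRlt e B U R'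

/-- A face of the arrangement: an intersection of a nonempty collection of regions. -/
def IsFace (e : ι → V) (F : Set V) : Prop :=
  ∃ Rs : Set (Set V), Rs.Nonempty ∧ (∀ R ∈ Rs, IsRegion e R) ∧ F = ⋂₀ Rs

/-- `[m, M]` is the facial interval of the face `F` in the poset of regions:
the regions containing `F` are exactly those between `m` and `M`. -/
def IsFacialInterval (e : ι → V) (B F m M : Set V) : Prop :=
  IsRegion e m ∧ IsRegion e M ∧
    ∀ R, IsRegion e R → (F ⊆ R ↔ (PRle e B m R ∧ PRle e B R M))

/-- The facial weak order `FW(𝒜,B)`: `F ≤ G` iff `m_F ≤ m_G` and `M_F ≤ M_G`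
in the poset of regions. -/
def FWle (e : ι → V) (B F G : Set V) : Prop :=
  ∃ mF MF mG MG, IsFacialInterval e B F mF MF ∧ IsFacialInterval e B G mG MG ∧
    PRle e B mF mG ∧ PRle e B MF MG

/-- Strict facial weak order. -/
def FWlt (e : ι → V) (B F G : Set V) : Prop := FWle e B F G ∧ F ≠ G

/-- Cover relation in the facial weak order. -/
def FWcover (e : ι → V) (B F G : Set V) : Prop :=
  FWlt e B F G ∧ ¬ ∃ X, IsFace e X ∧ FWlt e B F X ∧ FWlt e B X G

/-- Two faces have the same maximal region `M` of their facial intervals. -/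
def SameMax (e : ι → V) (B F G : Set V) : Prop :=
  ∃ m m' M, IsFacialInterval e B F m M ∧ IsFacialInterval e B G m' M

/-- Two faces have the same minimal region `m` of their facial intervals. -/
def SameMin (e : ι → V) (B F G : Set V) : Prop :=
  ∃ m M M', IsFacialInterval e B F m M ∧ IsFacialInterval e B G m M'

/-- The dimension of a face: the dimension of its linear span. -/
noncomputable def fdim (F : Set V) : ℕ := Module.finrank ℝ (Submodule.span ℝ F)

open Classical in
/-- The covector (sign vector) of a face: the sign of `⟪e i, x⟫` for `x` in the
relative interior of the face. -/
noncomputable def covec (e : ι → V) (F : Set V) (i : ι) : SignType :=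
  if ∀ x ∈ intrinsicInterior ℝ F, 0 < ⟪e i, x⟫ then 1
  else if ∀ x ∈ intrinsicInterior ℝ F, ⟪e i, x⟫ < 0 then -1
  else 0

/-- Composition of sign vectors. -/
def scomp (f g : ι → SignType) (i : ι) : SignType := if f i ≠ 0 then f i else g i

/-- The set of roots of the arrangement: the chosen normals and their opposites. -/
def roots (e : ι → V) : Set V := Set.range e ∪ Set.range (fun i => -(e i))

/-- The root inversion set of a face. -/
def rootInv (e : ι → V) (F : Set V) : Set V :=
  {v ∈ roots e | ∃ x ∈ intrinsicInterior ℝ F, ⟪x, v⟫ ≤ 0}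

/-- `H i` is a wall of the region `R`. -/
noncomputable def IsWall (e : ι → V) (R : Set V) (i : ι) : Prop :=
  fdim ({v : V | ⟪e i, v⟫ = 0} ∩ R) = Module.finrank ℝ V - 1

/-- A region is simplicial when the normal vectors of its walls are linearly independent. -/
def IsSimplicialRegion (e : ι → V) (R : Set V) : Prop :=
  LinearIndependent ℝ (fun i : {i : ι // IsWall e R i} => e i.1)

/-- The arrangement is simplicial when all its regions are. -/
def IsSimplicial (e : ι → V) : Prop := ∀ R, IsRegion e R → IsSimplicialRegion e R

/-- The arrangement is essential when the intersection of all its hyperplanes is `{0}`. -/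
def IsEssential (e : ι → V) : Prop := (⋂ i, {v : V | ⟪e i, v⟫ = 0}) = ({0} : Set V)

/-- The poset of regions is a lattice: any two regions have a join and a meet. -/
def PRIsLattice (e : ι → V) (B : Set V) : Prop :=
  ∀ R R', IsRegion e R → IsRegion e R' →
    (∃ J, IsRegion e J ∧ PRle e B R J ∧ PRle e B R' J ∧
      ∀ U, IsRegion e U → PRle e B R U → PRle e B R' U → PRle e B J U) ∧
    (∃ M, IsRegion e M ∧ PRle e B M R ∧ PRle e B M R' ∧
      ∀ U, IsRegion e U → PRle e B U R → PRle e B U R' → PRle e B U M)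

section SignVectors

variable {E κ : Type*} [AddCommGroup E] [Module ℝ E]

/-- Comparison of the sign vectors of two points for `- < 0 < +`, coordinatewise. -/
def SignLE (a : κ → E →ₗ[ℝ] ℝ) (x y : E) : Prop :=
  ∀ i, (0 < a i x → 0 < a i y) ∧ (0 ≤ a i x → 0 ≤ a i y)

/-- A point lying on none of the hyperplanes. -/
def Generic (a : κ → E →ₗ[ℝ] ℝ) (x : E) : Prop := ∀ i, a i x ≠ 0

/-- Any two generic sign vectors have a join among the generic ones. -/
def GenericJoins (a : κ → E →ₗ[ℝ] ℝ) : Prop :=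
  ∀ x y, Generic a x → Generic a y → ∃ z, Generic a z ∧ SignLE a x z ∧ SignLE a y z ∧
    ∀ u, Generic a u → SignLE a x u → SignLE a y u → SignLE a z u

theorem SignLE.trans {a : κ → E →ₗ[ℝ] ℝ} {x y z : E} (h : SignLE a x y) (h' : SignLE a y z) :
    SignLE a x z :=
  fun i => ⟨fun hi => (h' i).1 ((h i).1 hi), fun hi => (h' i).2 ((h i).2 hi)⟩

theorem Generic.signLE {a : κ → E →ₗ[ℝ] ℝ} {x y : E} (hx : Generic a x)
    (h : ∀ i, 0 < a i x → 0 < a i y) : SignLE a x y :=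
  fun i => ⟨h i, fun hi => (h i (lt_of_le_of_ne hi (hx i).symm)).le⟩

theorem Generic.neg {a : κ → E →ₗ[ℝ] ℝ} {x : E} (hx : Generic a x) : Generic a (-x) :=
  fun i => by simpa using hx i

theorem exists_pos_perturb [Finite κ] (p q : κ → ℝ) :
    ∃ ε : ℝ, 0 < ε ∧ ∀ i, (0 < p i → 0 < p i + ε * q i) ∧ (p i < 0 → p i + ε * q i < 0) := by
  have key : ∀ᶠ ε : ℝ in nhdsWithin 0 (Set.Ioi 0), ∀ i,
      (0 < p i → 0 < p i + ε * q i) ∧ (p i < 0 → p i + ε * q i < 0) := by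
    rw [Filter.eventually_all]
    intro i
    have hc : Filter.Tendsto (fun ε : ℝ => p i + ε * q i) (nhdsWithin 0 (Set.Ioi 0))
        (nhds (p i)) := by
      have : ContinuousAt (fun ε : ℝ => p i + ε * q i) 0 := by fun_prop
      have h := this.tendsto
      simp only [zero_mul, add_zero] at h
      exact h.mono_left nhdsWithin_le_nhds
    rcases lt_trichotomy (p i) 0 with h | h | h
    · filter_upwards [hc.eventually_lt_const h] with ε hε
      exact ⟨fun h' => absurd h' h.not_gt, fun _ => hε⟩
    · exact Filter.Eventually.of_forall fun ε =>
        ⟨fun h' => absurd h' h.not_gt, fun h' => absurd h h'.ne⟩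
    · filter_upwards [hc.eventually_const_lt h] with ε hε
      exact ⟨fun _ => hε, fun h' => absurd h' h.not_gt⟩
  obtain ⟨ε, h1, h2⟩ := (key.and self_mem_nhdsWithin).exists
  exact ⟨ε, h2, h1⟩

/-- The composition of two sign vectors is a sign vector. -/
theorem exists_comp [Finite κ] (a : κ → E →ₗ[ℝ] ℝ) (x y : E) :
    ∃ z, ∀ i, (0 < a i x → 0 < a i z) ∧ (a i x < 0 → a i z < 0) ∧
      (a i x = 0 → (0 < a i y → 0 < a i z) ∧ (a i y < 0 → a i z < 0) ∧
        (a i y = 0 → a i z = 0)) := by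
  obtain ⟨ε, hε, h⟩ := exists_pos_perturb (fun i => a i x) (fun i => a i y)
  refine ⟨x + ε • y, fun i => ?_⟩
  simp only [map_add, map_smul, smul_eq_mul]
  refine ⟨(h i).1, (h i).2, fun h0 => ?_⟩
  rw [h0, zero_add]
  exact ⟨fun hy => mul_pos hε hy, fun hy => mul_neg_of_pos_of_neg hε hy, fun hy => by simp [hy]⟩

/-- A convex set meeting all open orthants (with respect to finitely many functionals)
meets the common kernel of the functionals. -/
theorem exists_forall_eq_zero_of_orthants (a : κ → E →ₗ[ℝ] ℝ) (R : Finset κ) :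
    ∀ K : Set E, Convex ℝ K →
      (∀ S ⊆ R, ∃ x ∈ K, (∀ i ∈ S, 0 < a i x) ∧ ∀ i ∈ R, i ∉ S → a i x < 0) →
      ∃ x ∈ K, ∀ i ∈ R, a i x = 0 := by
  classical
  induction R using Finset.induction_on with
  | empty =>
    intro K _ h
    obtain ⟨x, hx, -⟩ := h ∅ (Finset.Subset.refl _)
    exact ⟨x, hx, by simp⟩
  | insert j R hj ih =>
    intro K hK h
    have hconv : Convex ℝ (K ∩ {x | a j x = 0}) := by
      refine hK.inter ?_
      intro x hx y hy s t _ _ _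
      simp only [Set.mem_ofPred_eq] at hx hy ⊢
      simp [hx, hy]
    obtain ⟨x, ⟨hxK, hxj⟩, hx⟩ := ih (K ∩ {x | a j x = 0}) hconv (by
      intro S hS
      have hjS : j ∉ S := fun h' => hj (hS h')
      obtain ⟨x, hxK, hx1, hx2⟩ := h (insert j S) (Finset.insert_subset_insert _ hS)
      obtain ⟨y, hyK, hy1, hy2⟩ := h S (hS.trans (Finset.subset_insert _ _))
      have hxj : 0 < a j x := hx1 j (Finset.mem_insert_self _ _)
      have hyj : a j y < 0 := hy2 j (Finset.mem_insert_self _ _) hjS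
      have hd : 0 < a j x - a j y := by linarith
      have hs : 0 < -a j y / (a j x - a j y) := div_pos (by linarith) hd
      have ht : 0 < a j x / (a j x - a j y) := div_pos hxj hd
      refine ⟨(-a j y / (a j x - a j y)) • x + (a j x / (a j x - a j y)) • y,
        ⟨hK hxK hyK hs.le ht.le ?_, ?_⟩, ?_, ?_⟩
      · field_simp; ring
      · simp only [Set.mem_ofPred_eq, map_add, map_smul, smul_eq_mul]
        field_simp; ring
      · intro i hi
        simp only [map_add, map_smul, smul_eq_mul]
        exact add_pos (mul_pos hs (hx1 i (Finset.mem_insert_of_mem hi))) (mul_pos ht (hy1 i hi))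
      · intro i hi hiS
        have hij : i ≠ j := fun h' => hj (h' ▸ hi)
        simp only [map_add, map_smul, smul_eq_mul]
        exact add_neg
          (mul_neg_of_pos_of_neg hs (hx2 i (Finset.mem_insert_of_mem hi) (by simp [hij, hiS])))
          (mul_neg_of_pos_of_neg ht (hy2 i (Finset.mem_insert_of_mem hi) hiS)))
    exact ⟨x, hxK, by simpa using ⟨hxj, hx⟩⟩

/-- The least generic sign vector above `m` which is positive on a set of upper walls of `m`. -/
theorem exists_least_generic {a : κ → E →ₗ[ℝ] ℝ} (hlat : GenericJoins a) {m : E}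
    (hm : Generic a m) (S : Finset κ)
    (hflip : ∀ s ∈ S, ∃ v, Generic a v ∧ 0 < a s v ∧
      ∀ T, Generic a T → SignLE a m T → 0 < a s T → SignLE a v T) :
    ∃ M, Generic a M ∧ SignLE a m M ∧ (∀ s ∈ S, 0 < a s M) ∧
      ∀ T, Generic a T → SignLE a m T → (∀ s ∈ S, 0 < a s T) → SignLE a M T := by
  classical
  induction S using Finset.induction_on with
  | empty => exact ⟨m, hm, fun i => ⟨id, id⟩, by simp, fun T _ h _ => h⟩
  | insert j S hj ih =>
    obtain ⟨M, hM, hmM, hMS, hleast⟩ := ih fun s hs => hflip s (Finset.mem_insert_of_mem hs)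
    obtain ⟨v, hv, hvj, hvT⟩ := hflip j (Finset.mem_insert_self _ _)
    obtain ⟨z, hz, hMz, hvz, hzl⟩ := hlat M v hM hv
    refine ⟨z, hz, hmM.trans hMz, ?_, ?_⟩
    · intro s hs
      rcases Finset.mem_insert.1 hs with rfl | hs
      · exact (hvz _).1 hvj
      · exact (hMz s).1 (hMS s hs)
    · intro T hT hmT hST
      exact hzl T hT (hleast T hT hmT fun s hs => hST s (Finset.mem_insert_of_mem hs))
        (hvT T hT hmT (hST j (Finset.mem_insert_self _ _)))

/-- The least sign vector that is positive where `m` is, nonnegative on a set `S` of upper walls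
of `m`, and positive on a subset `Q` of `S`. -/
theorem exists_least_signVector [Finite κ] {a : κ → E →ₗ[ℝ] ℝ} (hlat : GenericJoins a) {m : E}
    (hm : Generic a m) (S : Finset κ)
    (hflip : ∀ s ∈ S, ∃ v, Generic a v ∧ 0 < a s v ∧ (∀ t ∈ S, t ≠ s → a t v < 0) ∧
      ∀ T, Generic a T → SignLE a m T → 0 < a s T → SignLE a v T)
    (Q : Set κ) :
    ∃ k, (∀ i, 0 < a i m → 0 < a i k) ∧ (∀ s ∈ S, 0 ≤ a s k) ∧ (∀ s ∈ S, s ∈ Q → 0 < a s k) ∧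
      ∀ u, (∀ i, 0 < a i m → 0 < a i u) → (∀ s ∈ S, 0 ≤ a s u) →
        (∀ s ∈ S, s ∈ Q → 0 < a s u) → SignLE a k u := by
  classical
  have hjoin : ∀ R ⊆ S, ∃ M, Generic a M ∧ SignLE a m M ∧ (∀ s ∈ R, 0 < a s M) ∧
      ∀ T, Generic a T → SignLE a m T → (∀ s ∈ R, 0 < a s T) → SignLE a M T := fun R hR =>
    exists_least_generic hlat hm R fun s hs => by
      obtain ⟨v, h1, h2, -, h3⟩ := hflip s (hR hs)
      exact ⟨v, h1, h2, h3⟩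
  obtain ⟨M, hM, hmM, hMS, hMleast⟩ := hjoin S (Finset.Subset.refl _)
  -- a minimal subset of `S` with the same join
  obtain ⟨S₀, hS₀⟩ := Finset.exists_minimal
    (s := S.powerset.filter fun R =>
      ∀ T, Generic a T → SignLE a m T → (∀ s ∈ R, 0 < a s T) → SignLE a M T)
    ⟨S, by simpa using hMleast⟩
  obtain ⟨hS₀S, hS₀least⟩ : S₀ ⊆ S ∧
      ∀ T, Generic a T → SignLE a m T → (∀ s ∈ S₀, 0 < a s T) → SignLE a M T := by
    simpa using hS₀.1
  have hirr : ∀ s ∈ S₀, ∃ D, Generic a D ∧ SignLE a m D ∧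
      (∀ t ∈ S₀, t ≠ s → 0 < a t D) ∧ a s D < 0 := by
    intro s hs
    obtain ⟨D, hD, hmD, hDS, hDleast⟩ := hjoin (S₀.erase s) ((Finset.erase_subset _ _).trans hS₀S)
    have hD' : ∀ t ∈ S₀, t ≠ s → 0 < a t D := fun t ht hts =>
      hDS t (Finset.mem_erase.2 ⟨hts, ht⟩)
    refine ⟨D, hD, hmD, hD', ?_⟩
    by_contra hneg
    have hpos : 0 < a s D := lt_of_le_of_ne (not_lt.1 hneg) (hD s).symm
    have hMD : SignLE a M D := hS₀least D hD hmD fun t ht => by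
      by_cases hts : t = s
      · exact hts ▸ hpos
      · exact hD' t ht hts
    have hmem : S₀.erase s ∈ S.powerset.filter fun R =>
        ∀ T, Generic a T → SignLE a m T → (∀ s ∈ R, 0 < a s T) → SignLE a M T := by
      simp only [Finset.mem_filter, Finset.mem_powerset]
      exact ⟨(Finset.erase_subset _ _).trans hS₀S, fun T hT hmT hTS =>
        hMD.trans (hDleast T hT hmT hTS)⟩
    exact Finset.notMem_erase s S₀ (hS₀.2 hmem (Finset.erase_subset _ _) hs)
  obtain ⟨k, ⟨hkP, hkN, hkQ⟩, hk0⟩ := exists_forall_eq_zero_of_orthants a (S₀.filter (· ∉ Q))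
    {x | (∀ i, 0 < a i m → 0 < a i x) ∧ (∀ i, a i M < 0 → a i x < 0) ∧
      ∀ s ∈ S₀, s ∈ Q → 0 < a s x}
    (by
      intro x hx y hy s t hs ht hst
      have hcomb : ∀ p q : ℝ, 0 < p → 0 < q → 0 < s * p + t * q := by
        intro p q hp hq
        rcases hs.eq_or_lt with rfl | hs
        · have : t = 1 := by linarith
          simpa [this] using hq
        · exact add_pos_of_pos_of_nonneg (mul_pos hs hp) (mul_nonneg ht hq.le)
      simp only [Set.mem_ofPred_eq, map_add, map_smul, smul_eq_mul] at hx hy ⊢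
      refine ⟨fun i hi => hcomb _ _ (hx.1 i hi) (hy.1 i hi), fun i hi => ?_,
        fun i hi hiQ => hcomb _ _ (hx.2.2 i hi hiQ) (hy.2.2 i hi hiQ)⟩
      have := hcomb (-a i x) (-a i y) (by linarith [hx.2.1 i hi]) (by linarith [hy.2.1 i hi])
      linarith)
    (by
      intro R hR
      have hRS : R ∪ S₀.filter (· ∈ Q) ⊆ S₀ :=
        Finset.union_subset (hR.trans (Finset.filter_subset _ _)) (Finset.filter_subset _ _)
      obtain ⟨D, hD, hmD, hDS, hDleast⟩ := hjoin _ (hRS.trans hS₀S)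
      have hDM : SignLE a D M := hDleast M hM hmM fun s hs => hMS s (hS₀S (hRS hs))
      refine ⟨D, ⟨fun i hi => (hmD i).1 hi, fun i hi => ?_, fun s hs hsQ => hDS s ?_⟩,
        fun i hi => hDS i (Finset.mem_union_left _ hi), fun i hi hiR => ?_⟩
      · by_contra h
        exact absurd ((hDM i).2 (not_lt.1 h)) hi.not_ge
      · exact Finset.mem_union_right _ (Finset.mem_filter.2 ⟨hs, hsQ⟩)
      · obtain ⟨hiS, hiQ⟩ := Finset.mem_filter.1 hi
        obtain ⟨C, hC, hmC, hCS, hCi⟩ := hirr i hiS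
        have hDC : SignLE a D C := hDleast C hC hmC fun s hs =>
          hCS s (hRS hs) fun hsi => by
            subst hsi
            rcases Finset.mem_union.1 hs with h | h
            · exact hiR h
            · exact hiQ (Finset.mem_filter.1 h).2
        by_contra h
        exact absurd ((hDC i).2 (not_lt.1 h)) hCi.not_ge)
  have hk0' : ∀ s ∈ S₀, s ∉ Q → a s k = 0 := fun s hs hsQ =>
    hk0 s (Finset.mem_filter.2 ⟨hs, hsQ⟩)
  -- the composition of `k` with a generic vector positive on `S₀` is above `M`
  have hcomp : ∀ T, Generic a T → (∀ s ∈ S₀, 0 < a s T) → ∃ K, SignLE a M K ∧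
      ∀ i, (0 < a i K → 0 ≤ a i k) ∧ (0 < a i K → a i k = 0 → 0 < a i T) := by
    intro T hT hTS
    obtain ⟨K, hK⟩ := exists_comp a k T
    have hKgen : Generic a K := by
      intro i
      have := hK i
      have := hT i
      grind
    refine ⟨K, hS₀least K hKgen (hm.signLE fun i hi => (hK i).1 (hkP i hi)) fun s hs => ?_,
      fun i => ?_⟩
    · have := hK s
      have := hTS s hs
      have := hkQ s hs
      have := hk0' s hs
      grind
    · have := hK i
      grind
  have hkM : ∀ i, 0 < a i M → 0 ≤ a i k := by
    obtain ⟨K, hMK, hK⟩ := hcomp M hM fun s hs => hMS s (hS₀S hs)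
    exact fun i hi => (hK i).1 ((hMK i).1 hi)
  refine ⟨k, hkP, fun s hs => hkM s (hMS s hs), fun q hq hqQ => ?_, fun u huP huS huQ => ?_⟩
  · by_cases hqS : q ∈ S₀
    · exact hkQ q hqS hqQ
    · refine lt_of_le_of_ne (hkM q (hMS q hq)) fun h0 => ?_
      obtain ⟨v, hv, hvq, hvS, -⟩ := hflip q hq
      obtain ⟨K, hMK, hK⟩ := hcomp (-v) hv.neg fun s hs => by
        have := hvS s (hS₀S hs) fun h => hqS (h ▸ hs)
        simpa using this
      have := (hK q).2 ((hMK q).1 (hMS q hq)) h0.symm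
      rw [map_neg] at this
      linarith
  · obtain ⟨C, hC⟩ := exists_comp a (-k) M
    obtain ⟨T, hT⟩ := exists_comp a u C
    simp only [map_neg] at hC
    have hTgen : Generic a T := by
      intro i
      have := hC i
      have := hT i
      have := hM i
      grind
    have hMT : SignLE a M T :=
      hS₀least T hTgen (hm.signLE fun i hi => (hT i).1 (huP i hi)) fun s hs => by
        have := hC s
        have := hT s
        have := huS s (hS₀S hs)
        have := huQ s (hS₀S hs)
        have := hk0' s hs
        have := hMS s (hS₀S hs)
        grind
    intro i
    have := hMT i
    have := hT i
    have := hC i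
    have := hkN i
    have := hM i
    constructor <;> grind

/-- The walls of a generic point `m`: an irredundant set of inequalities for its region. -/
theorem exists_walls [Finite κ] (a : κ → E →ₗ[ℝ] ℝ) {m : E} (hm : Generic a m) :
    ∃ W : Finset κ,
      (∀ v, (∀ w ∈ W, 0 < a w m * a w v) → ∀ i, 0 < a i m * a i v) ∧
      ∀ w ∈ W, a w m < 0 → ∃ v, Generic a v ∧ 0 < a w v ∧
        (∀ t ∈ W, t ≠ w → 0 < a t m * a t v) ∧
        ∀ T, Generic a T → SignLE a m T → 0 < a w T → SignLE a v T := by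
  classical
  cases nonempty_fintype κ
  obtain ⟨W, hW⟩ := Finset.exists_minimal
    (s := Finset.univ.filter fun R : Finset κ =>
      ∀ v, (∀ w ∈ R, 0 < a w m * a w v) → ∀ i, 0 < a i m * a i v)
    ⟨Finset.univ, by simp⟩
  have hgen : ∀ v, (∀ w ∈ W, 0 < a w m * a w v) → ∀ i, 0 < a i m * a i v := by
    simpa using hW.1
  refine ⟨W, hgen, fun w hw hwm => ?_⟩
  have hmm : ∀ i, 0 < a i m * a i m := fun i => mul_self_pos.2 (hm i)
  obtain ⟨x, hx, hxw⟩ : ∃ x, (∀ t ∈ W, t ≠ w → 0 < a t m * a t x) ∧ a w m * a w x ≤ 0 := by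
    by_contra! hcon
    have hmem : W.erase w ∈ Finset.univ.filter fun R : Finset κ =>
        ∀ v, (∀ w ∈ R, 0 < a w m * a w v) → ∀ i, 0 < a i m * a i v := by
      simp only [Finset.mem_filter, Finset.mem_univ, true_and]
      intro v hv
      have hv' : ∀ t ∈ W, t ≠ w → 0 < a t m * a t v := fun t ht htw =>
        hv t (Finset.mem_erase.2 ⟨htw, ht⟩)
      refine hgen v fun t ht => ?_
      by_cases htw : t = w
      · exact htw ▸ hcon v hv'
      · exact hv' t ht htw
    exact Finset.notMem_erase w W (hW.2 hmem (Finset.erase_subset _ _) hw)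
  -- a point in the relative interior of the facet
  obtain ⟨y, hy, hyw⟩ : ∃ y, (∀ t ∈ W, t ≠ w → 0 < a t m * a t y) ∧ a w y = 0 := by
    refine ⟨(a w m * a w m) • x + (-(a w m * a w x)) • m, fun t ht htw => ?_, ?_⟩
    · simp only [map_add, map_smul, smul_eq_mul]
      have h1 := mul_pos (hmm w) (hx t ht htw)
      have h2 := mul_nonneg (neg_nonneg.2 hxw) (hmm t).le
      nlinarith
    · simp only [map_add, map_smul, smul_eq_mul]
      ring
  have hfacet : ∀ d, 0 < a w m * a w d → ∃ ε : ℝ, 0 < ε ∧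
      ∀ i, 0 < a i m * (a i y + ε * a i d) := by
    intro d hd
    obtain ⟨ε, hε, hp⟩ := exists_pos_perturb (fun i => a i m * a i y) (fun i => a i m * a i d)
    refine ⟨ε, hε, fun i => ?_⟩
    have := hgen (y + ε • d) (fun t ht => by
      simp only [map_add, map_smul, smul_eq_mul]
      by_cases htw : t = w
      · subst htw
        rw [hyw, zero_add]
        have := mul_pos hε hd
        nlinarith
      · have := (hp t).1 (hy t ht htw)
        nlinarith) i
    simpa using this
  have hynonneg : ∀ i, 0 ≤ a i m * a i y := by
    intro i
    by_contra! h
    obtain ⟨ε, hε, hp⟩ := exists_pos_perturb (fun i => a i m * a i y) (fun i => a i m * a i m)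
    have := hgen (y + ε • m) (fun t ht => by
      simp only [map_add, map_smul, smul_eq_mul]
      by_cases htw : t = w
      · subst htw
        rw [hyw, zero_add]
        have := mul_pos hε (hmm t)
        nlinarith
      · have := (hp t).1 (hy t ht htw)
        nlinarith) i
    have h3 := (hp i).2 h
    simp only [map_add, map_smul, smul_eq_mul] at this
    nlinarith
  have hpar : ∀ i, a i y = 0 → ∀ d, 0 < a w m * a w d → 0 < a i m * a i d := by
    intro i hi d hd
    obtain ⟨ε, hε, h⟩ := hfacet d hd
    have := h i
    rw [hi, zero_add] at this
    exact pos_of_mul_pos_right (a := ε) (by nlinarith) hε.le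
  obtain ⟨v, hv⟩ := exists_comp a y (-m)
  simp only [map_neg] at hv
  have hvgen : Generic a v := by
    intro i
    have := hv i
    have := hm i
    grind
  refine ⟨v, hvgen, ((hv w).2.2 hyw).1 (by linarith), fun t ht htw => ?_, fun T hT hmT hTw => ?_⟩
  · rcases pos_and_pos_or_neg_and_neg_of_mul_pos (hy t ht htw) with h | h
    · exact mul_pos h.1 ((hv t).1 h.2)
    · exact mul_pos_of_neg_of_neg h.1 ((hv t).2.1 h.2)
  · refine hvgen.signLE fun i hi => ?_
    by_cases hiy : a i y = 0
    · have h1 := hpar i hiy (-T) (by rw [map_neg]; nlinarith)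
      have h2 := (hv i).2.2 hiy
      have h3 := hm i
      rw [map_neg] at h1
      have h4 : a i m < 0 := by grind
      nlinarith
    · have h1 := lt_of_le_of_ne (hynonneg i) (mul_ne_zero (hm i) hiy).symm
      have h2 := hv i
      refine (hmT i).1 ?_
      have h3 : 0 < a i y := by grind
      exact pos_of_mul_pos_left h1 h3.le

/-- Nonnegativity on the walls of `m` through a point `x` of the region of `m` propagates to all
hyperplanes through `x`. -/
theorem nonneg_of_walls [Finite κ] {a : κ → E →ₗ[ℝ] ℝ} {m x u : E} (hm : Generic a m)
    {W : Finset κ} (hW : ∀ v, (∀ w ∈ W, 0 < a w m * a w v) → ∀ i, 0 < a i m * a i v)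
    (hxm : ∀ i, (0 < a i m → 0 < a i x) ∧ (a i m < 0 → a i x ≤ 0))
    (hu : ∀ w ∈ W, a w x = 0 → 0 ≤ a w u) (r : κ) (hr : a r x = 0) : 0 ≤ a r u := by
  have hrm : a r m < 0 := by
    have := hxm r
    have := hm r
    grind
  by_contra! hneg
  obtain ⟨δ, hδ, hδr⟩ : ∃ δ : ℝ, 0 < δ ∧ a r u - δ * a r m < 0 := by
    refine ⟨a r u / (2 * a r m), div_pos_of_neg_of_neg hneg (by linarith), ?_⟩
    have hne := hrm.ne
    have : a r u / (2 * a r m) * a r m = a r u / 2 := by field_simp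
    linarith
  obtain ⟨ε, hε, hp⟩ := exists_pos_perturb (fun i => a i m * a i x)
    (fun i => a i m * (-a i u + δ * a i m))
  have := hW (x + ε • (-u + δ • m)) (fun w hw => by
    simp only [map_add, map_smul, smul_eq_mul, map_neg]
    by_cases hwx : a w x = 0
    · have hwm : a w m < 0 := by
        have := hxm w
        have := hm w
        grind
      have h1 := hu w hw hwx
      rw [hwx, zero_add]
      refine mul_pos_of_neg_of_neg hwm (mul_neg_of_pos_of_neg hε ?_)
      nlinarith
    · have h1 : 0 < a w m * a w x := by
        rcases (hm w).lt_or_gt with h | h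
        · exact mul_pos_of_neg_of_neg h (lt_of_le_of_ne ((hxm w).2 h) hwx)
        · exact mul_pos h ((hxm w).1 h)
      have := (hp w).1 h1
      nlinarith) r
  simp only [map_add, map_smul, smul_eq_mul, map_neg, hr, zero_add] at this
  have h2 : 0 < ε * (-a r u + δ * a r m) := mul_pos hε (by linarith)
  nlinarith

/-- Strict version of `nonneg_of_walls`. -/
theorem pos_of_walls [Finite κ] {a : κ → E →ₗ[ℝ] ℝ} {m x u y : E} (hm : Generic a m)
    {W : Finset κ} (hW : ∀ v, (∀ w ∈ W, 0 < a w m * a w v) → ∀ i, 0 < a i m * a i v)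
    (hxm : ∀ i, (0 < a i m → 0 < a i x) ∧ (a i m < 0 → a i x ≤ 0))
    (hu : ∀ w ∈ W, a w x = 0 → 0 ≤ a w u)
    (huy : ∀ w ∈ W, a w x = 0 → 0 < a w y → 0 < a w u)
    (r : κ) (hr : a r x = 0) (hry : 0 < a r y) : 0 < a r u := by
  obtain ⟨δ, hδ, hp⟩ := exists_pos_perturb (fun i => a i u) (fun i => -a i y)
  have h := nonneg_of_walls (u := u - δ • y) hm hW hxm (fun w hw hwx => by
    simp only [map_sub, map_smul, smul_eq_mul]
    by_cases hy : 0 < a w y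
    · have := (hp w).1 (huy w hw hwx hy)
      linarith
    · have := hu w hw hwx
      nlinarith) r hr
  simp only [map_sub, map_smul, smul_eq_mul] at h
  have := mul_pos hδ hry
  linarith

/-- Shape of the covers of the coordinatewise order on sign vectors. -/
theorem cover_shape [Finite κ] {a : κ → E →ₗ[ℝ] ℝ} {z x : E} (hzx : SignLE a z x)
    (hxz : ¬ SignLE a x z)
    (hcov : ∀ w, SignLE a z w → SignLE a w x → SignLE a w z ∨ SignLE a x w) :
    (∀ i, (0 < a i z → 0 < a i x) ∧ (a i z < 0 → a i x < 0)) ∨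
    (∀ i, (0 < a i x → 0 < a i z) ∧ (a i x < 0 → a i z < 0)) := by
  obtain ⟨w, hw⟩ := exists_comp a z x
  obtain ⟨w', hw'⟩ := exists_comp a x z
  have h1 : SignLE a z w := fun i => by
    have := hw i; have := hzx i; constructor <;> grind
  have h2 : SignLE a w x := fun i => by
    have := hw i; have := hzx i; constructor <;> grind
  have h3 : SignLE a z w' := fun i => by
    have := hw' i; have := hzx i; constructor <;> grind
  have h4 : SignLE a w' x := fun i => by
    have := hw' i; have := hzx i; constructor <;> grind
  rcases hcov w h1 h2 with h5 | h5
  swap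
  · refine Or.inl fun i => ?_
    have := hw i; have := hzx i; have := h5 i
    constructor <;> grind
  rcases hcov w' h3 h4 with h6 | h6
  · refine Or.inr fun i => ?_
    have := hw' i; have := hzx i; have := h6 i
    constructor <;> grind
  have hzero : ∀ i, a i z = 0 ↔ a i x = 0 := fun i => by
    have := hw i; have := hw' i; have := hzx i; have := h5 i; have := h6 i
    constructor <;> grind
  exfalso
  obtain ⟨i, hzi, hxi⟩ : ∃ i, a i z < 0 ∧ 0 < a i x := by
    by_contra! hcon
    refine hxz fun i => ?_
    have := hcon i; have := hzero i
    constructor <;> grind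
  have hval : ∀ j, a j ((-a i z) • x + (a i x) • z) = (-a i z) * a j x + a i x * a j z := by
    intro j; simp
  have hz' : 0 < -a i z := by linarith
  have h7 : SignLE a z ((-a i z) • x + (a i x) • z) := fun j => by
    rw [hval]
    exact ⟨fun h => add_pos (mul_pos hz' ((hzx j).1 h)) (mul_pos hxi h),
      fun h => add_nonneg (mul_nonneg hz'.le ((hzx j).2 h)) (mul_nonneg hxi.le h)⟩
  have h8 : SignLE a ((-a i z) • x + (a i x) • z) x := fun j => by
    rw [hval]
    constructor
    · intro h
      by_contra hx
      have hz : a j z ≤ 0 := not_lt.1 fun h' => hx ((hzx j).1 h')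
      nlinarith [mul_nonneg hz'.le (neg_nonneg.2 (not_lt.1 hx)),
        mul_nonneg hxi.le (neg_nonneg.2 hz)]
    · intro h
      by_contra hx
      have hz : a j z < 0 := not_le.1 fun h' => hx ((hzx j).2 h')
      nlinarith [mul_pos hz' (neg_pos.2 (not_le.1 hx)), mul_pos hxi (neg_pos.2 hz)]
  have hi0 : (-a i z) * a i x + a i x * a i z = 0 := by ring
  rcases hcov _ h7 h8 with h9 | h9
  · have := (h9 i).2
    rw [hval, hi0] at this
    exact absurd (this le_rfl) hzi.not_ge
  · have := (h9 i).1 hxi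
    rw [hval, hi0] at this
    exact lt_irrefl _ this

/-- If the generic sign vector `m` refines `x` and `x'` with the same positive part, and `y` is
nonnegative only where `m` is positive or `x` vanishes, then `x`, `x'` and `y` have a join. -/
theorem exists_join_of_walls [Finite κ] {a : κ → E →ₗ[ℝ] ℝ} (hlat : GenericJoins a)
    {m x x' y : E} (hm : Generic a m)
    (hxm : ∀ i, (0 < a i m → 0 < a i x) ∧ (a i m < 0 → a i x ≤ 0))
    (hxm' : ∀ i, (0 < a i m → 0 < a i x') ∧ (a i m < 0 → a i x' ≤ 0))
    (hy : ∀ i, 0 ≤ a i y → 0 < a i m ∨ a i x = 0) :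
    ∃ k, SignLE a x k ∧ SignLE a x' k ∧ SignLE a y k ∧
      ∀ u, SignLE a x u → SignLE a x' u → SignLE a y u → SignLE a k u := by
  classical
  obtain ⟨W, hW, hWflip⟩ := exists_walls a hm
  have hneg : ∀ i, a i x = 0 ∨ a i x' = 0 → a i m < 0 := fun i hi => by
    have := hxm i; have := hxm' i; have := hm i
    grind
  obtain ⟨k, hkP, hkS, hkQ, hk⟩ := exists_least_signVector hlat hm
    (W.filter fun w => a w x = 0 ∨ a w x' = 0)
    (fun s hs => by
      obtain ⟨hsW, hs0⟩ := Finset.mem_filter.1 hs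
      obtain ⟨v, h1, h2, h3, h4⟩ := hWflip s hsW (hneg s hs0)
      refine ⟨v, h1, h2, fun t ht hts => ?_, h4⟩
      obtain ⟨htW, ht0⟩ := Finset.mem_filter.1 ht
      have := h3 t htW hts
      have := hneg t ht0
      by_contra! h
      nlinarith)
    {w | a w x = 0 ∧ 0 < a w y}
  have hx0 : ∀ w ∈ W, a w x = 0 → 0 ≤ a w k := fun w hw h =>
    hkS w (Finset.mem_filter.2 ⟨hw, Or.inl h⟩)
  have hx0' : ∀ w ∈ W, a w x' = 0 → 0 ≤ a w k := fun w hw h =>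
    hkS w (Finset.mem_filter.2 ⟨hw, Or.inr h⟩)
  have hk1 := nonneg_of_walls hm hW hxm hx0
  have hk2 := nonneg_of_walls hm hW hxm' hx0'
  have hk3 := pos_of_walls (y := y) hm hW hxm hx0 fun w hw h h' =>
    hkQ w (Finset.mem_filter.2 ⟨hw, Or.inl h⟩) ⟨h, h'⟩
  refine ⟨k, fun i => ?_, fun i => ?_, fun i => ?_, fun u hxu hxu' hyu => ?_⟩
  · have := hxm i; have := hm i; have := hkP i; have := hk1 i
    constructor <;> grind
  · have := hxm' i; have := hm i; have := hkP i; have := hk2 i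
    constructor <;> grind
  · have := hy i; have := hkP i; have := hk1 i; have := hk3 i
    constructor <;> grind
  · refine hk u (fun i hi => (hxu i).1 ((hxm i).1 hi)) (fun s hs => ?_) fun s _ hsQ =>
      (hyu s).1 hsQ.2
    rcases (Finset.mem_filter.1 hs).2 with h | h
    · exact (hxu s).2 h.ge
    · exact (hxu' s).2 h.ge

/-- Two covers of a sign vector have a join if the generic sign vectors have joins. -/
theorem exists_join_of_covers [Finite κ] {a : κ → E →ₗ[ℝ] ℝ} (hlat : GenericJoins a)
    {b : E} (hb : ∀ i, a i b < 0) {z x y : E}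
    (hzx : SignLE a z x) (hxz : ¬ SignLE a x z)
    (hcovx : ∀ w, SignLE a z w → SignLE a w x → SignLE a w z ∨ SignLE a x w)
    (hzy : SignLE a z y) (hyz : ¬ SignLE a y z)
    (hcovy : ∀ w, SignLE a z w → SignLE a w y → SignLE a w z ∨ SignLE a y w) :
    ∃ k, SignLE a x k ∧ SignLE a y k ∧
      ∀ u, SignLE a x u → SignLE a y u → SignLE a k u := by
  obtain ⟨m, hmz⟩ := exists_comp a z b
  have hm : Generic a m := fun i => by
    have := hmz i; have := hb i
    grind
  rcases cover_shape hzx hxz hcovx with hx | hx <;> rcases cover_shape hzy hyz hcovy with hy | hy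
  · obtain ⟨k, hk⟩ := exists_comp a x y
    refine ⟨k, fun i => ?_, fun i => ?_, fun u hxu hyu i => ?_⟩
    · have := hk i; have := hzx i; have := hzy i; have := hx i; have := hy i
      constructor <;> grind
    · have := hk i; have := hzx i; have := hzy i; have := hx i; have := hy i
      constructor <;> grind
    · have := hk i; have := hzx i; have := hzy i; have := hx i; have := hy i
      have := hxu i; have := hyu i
      constructor <;> grind
  · have hym : ∀ i, (0 < a i m → 0 < a i y) ∧ (a i m < 0 → a i y ≤ 0) := fun i => by
      have := hmz i; have := hb i; have := hzy i; have := hy i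
      constructor <;> grind
    obtain ⟨k, h1, -, h2, h3⟩ := exists_join_of_walls hlat (y := x) hm hym hym fun i hi => by
      have := hmz i; have := hb i; have := hzy i; have := hy i; have := hx i
      grind
    exact ⟨k, h2, h1, fun u hxu hyu => h3 u hyu hyu hxu⟩
  · have hxm : ∀ i, (0 < a i m → 0 < a i x) ∧ (a i m < 0 → a i x ≤ 0) := fun i => by
      have := hmz i; have := hb i; have := hzx i; have := hx i
      constructor <;> grind
    obtain ⟨k, h1, -, h2, h3⟩ := exists_join_of_walls hlat (y := y) hm hxm hxm fun i hi => by
      have := hmz i; have := hb i; have := hzx i; have := hy i; have := hx i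
      grind
    exact ⟨k, h1, h2, fun u hxu hyu => h3 u hxu hxu hyu⟩
  · have hxm : ∀ i, (0 < a i m → 0 < a i x) ∧ (a i m < 0 → a i x ≤ 0) := fun i => by
      have := hmz i; have := hb i; have := hzx i; have := hx i
      constructor <;> grind
    have hym : ∀ i, (0 < a i m → 0 < a i y) ∧ (a i m < 0 → a i y ≤ 0) := fun i => by
      have := hmz i; have := hb i; have := hzy i; have := hy i
      constructor <;> grind
    obtain ⟨k, h1, h2, -, h3⟩ := exists_join_of_walls hlat (y := x) hm hxm hym fun i hi => by
      have := hm i; have := hxm i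
      grind
    exact ⟨k, h1, h2, fun u hxu hyu => h3 u hxu hyu hxu⟩

end SignVectors

section Translation

set_option linter.unusedSectionVars false

/-- The functionals `v ↦ -⟪e i, v⟫`, nonnegative on the regions separated from the base. -/
noncomputable def negNormal (e : ι → V) (i : ι) : V →ₗ[ℝ] ℝ := (innerₗ V (-(e i)))

theorem negNormal_apply (e : ι → V) (i : ι) (v : V) : negNormal e i v = -⟪e i, v⟫ := by
  simp [negNormal]

/-- The closed face with `x` in its relative interior. -/
def closedFace (e : ι → V) (x : V) : Set V :=
  {v | ∀ i, (⟪e i, x⟫ = 0 → ⟪e i, v⟫ = 0) ∧ 0 ≤ ⟪e i, x⟫ * ⟪e i, v⟫}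

theorem mem_closedFace {e : ι → V} {x v : V} : v ∈ closedFace e x ↔
    ∀ i, (⟪e i, x⟫ = 0 → ⟪e i, v⟫ = 0) ∧ 0 ≤ ⟪e i, x⟫ * ⟪e i, v⟫ := Iff.rfl

theorem self_mem_closedFace (e : ι → V) (x : V) : x ∈ closedFace e x :=
  fun _ => ⟨id, mul_self_nonneg _⟩

theorem mem_closedFace_of_generic {e : ι → V} {x v : V} (hx : x ∈ arrComplement e) :
    v ∈ closedFace e x ↔ ∀ i, 0 ≤ ⟪e i, x⟫ * ⟪e i, v⟫ :=
  ⟨fun h i => (h i).2, fun h i => ⟨fun h0 => absurd h0 (hx i), h i⟩⟩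

theorem connectedComponentIn_arrComplement {e : ι → V} {x : V} (hx : x ∈ arrComplement e) :
    connectedComponentIn (arrComplement e) x = {v | ∀ i, 0 < ⟪e i, x⟫ * ⟪e i, v⟫} := by
  apply Set.Subset.antisymm
  · intro v hv i
    have hpre : IsPreconnected ((fun w => ⟪e i, x⟫ * ⟪e i, w⟫) ''
        connectedComponentIn (arrComplement e) x) :=
      isPreconnected_connectedComponentIn.image _ (by fun_prop)
    have h1 : ⟪e i, x⟫ * ⟪e i, x⟫ ∈ (fun w => ⟪e i, x⟫ * ⟪e i, w⟫) ''
        connectedComponentIn (arrComplement e) x := ⟨x, mem_connectedComponentIn hx, rfl⟩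
    have h2 : ⟪e i, x⟫ * ⟪e i, v⟫ ∈ (fun w => ⟪e i, x⟫ * ⟪e i, w⟫) ''
        connectedComponentIn (arrComplement e) x := ⟨v, hv, rfl⟩
    by_contra hneg
    obtain ⟨w, hw, hw0⟩ := hpre.ordConnected.out h2 h1
      ⟨not_lt.1 hneg, mul_self_nonneg _⟩
    exact mul_ne_zero (hx i) (connectedComponentIn_subset _ _ hw i) hw0
  · refine IsPreconnected.subset_connectedComponentIn ?_ (fun i => mul_self_pos.2 (hx i)) ?_
    · refine Convex.isPreconnected ?_
      intro y hy z hz s t hs ht hst i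
      have h1 := hy i
      have h2 := hz i
      rw [inner_add_right, inner_smul_right, inner_smul_right]
      rcases hs.eq_or_lt with rfl | hs
      · have : t = 1 := by linarith
        simpa [this] using h2
      · nlinarith [mul_pos hs h1, mul_nonneg ht h2.le]
    · intro v hv i h0
      have := hv i
      rw [h0, mul_zero] at this
      exact lt_irrefl _ this

theorem closure_connectedComponentIn {e : ι → V} {x : V} (hx : x ∈ arrComplement e) :
    closure (connectedComponentIn (arrComplement e) x) = closedFace e x := by
  rw [connectedComponentIn_arrComplement hx]
  apply Set.Subset.antisymm
  · refine closure_minimal (fun v hv => (mem_closedFace_of_generic hx).2 fun i => (hv i).le) ?_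
    have : closedFace e x = ⋂ i, {v | 0 ≤ ⟪e i, x⟫ * ⟪e i, v⟫} := by
      ext v
      simp [mem_closedFace_of_generic hx]
    rw [this]
    exact isClosed_iInter fun i => isClosed_le continuous_const (by fun_prop)
  · intro v hv
    have hlim : Filter.Tendsto (fun ε : ℝ => v + ε • x) (nhdsWithin 0 (Set.Ioi 0)) (nhds v) := by
      have : ContinuousAt (fun ε : ℝ => v + ε • x) 0 := by fun_prop
      have h := this.tendsto
      simp only [zero_smul, add_zero] at h
      exact h.mono_left nhdsWithin_le_nhds
    refine mem_closure_of_tendsto hlim ?_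
    filter_upwards [self_mem_nhdsWithin] with ε hε i
    rw [inner_add_right, inner_smul_right]
    have h1 := (hv i).2
    have h2 := mul_pos (Set.mem_Ioi.1 hε) (mul_self_pos.2 (hx i))
    nlinarith

theorem isRegion_iff {e : ι → V} {R : Set V} :
    IsRegion e R ↔ ∃ x ∈ arrComplement e, R = closedFace e x := by
  constructor <;> rintro ⟨x, hx, rfl⟩
  · exact ⟨x, hx, closure_connectedComponentIn hx⟩
  · exact ⟨x, hx, (closure_connectedComponentIn hx).symm⟩

theorem sepSet_closedFace {e : ι → V} {b x : V} (hb : ∀ i, 0 < ⟪e i, b⟫)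
    (hx : x ∈ arrComplement e) :
    sepSet e (closedFace e b) (closedFace e x) = {i | ⟪e i, x⟫ < 0} := by
  ext i
  constructor
  · rintro (⟨-, h⟩ | ⟨h, -⟩)
    · exact lt_of_le_of_ne (h (self_mem_closedFace e x)) (hx i)
    · exact absurd (h (self_mem_closedFace e b)) (hb i).not_ge
  · intro hi
    refine Or.inl ⟨fun v hv => ?_, fun v hv => ?_⟩
    · exact nonneg_of_mul_nonneg_right (hv i).2 (hb i)
    · exact nonpos_of_mul_nonneg_right (hv i).2 hi

theorem prle_closedFace {e : ι → V} {b x y : V} (hb : ∀ i, 0 < ⟪e i, b⟫)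
    (hx : x ∈ arrComplement e) (hy : y ∈ arrComplement e) :
    PRle e (closedFace e b) (closedFace e x) (closedFace e y) ↔
      ∀ i, ⟪e i, x⟫ < 0 → ⟪e i, y⟫ < 0 := by
  rw [PRle, sepSet_closedFace hb hx, sepSet_closedFace hb hy]
  rfl

theorem closedFace_subset_iff {e : ι → V} {x y : V} (hy : y ∈ arrComplement e) :
    closedFace e x ⊆ closedFace e y ↔ ∀ i, 0 ≤ ⟪e i, y⟫ * ⟪e i, x⟫ := by
  constructor
  · exact fun h i => (h (self_mem_closedFace e x) i).2
  · intro h v hv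
    rw [mem_closedFace_of_generic hy]
    intro i
    have h1 := h i
    obtain ⟨h2, h3⟩ := hv i
    by_cases h0 : ⟪e i, x⟫ = 0
    · simp [h2 h0]
    · by_contra! h4
      have h5 := lt_of_le_of_ne h1 (mul_ne_zero (hy i) h0).symm
      nlinarith [mul_nonneg h1 h3, mul_self_pos.2 h0, mul_pos_of_neg_of_neg h4 h4]

/-- The extreme regions containing a given face. -/
theorem exists_extreme_points {e : ι → V} {b : V} (hb : ∀ i, 0 < ⟪e i, b⟫) (x : V) :
    ∃ m ∈ arrComplement e, ∃ M ∈ arrComplement e,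
      (∀ i, ⟪e i, m⟫ < 0 ↔ ⟪e i, x⟫ < 0) ∧ (∀ i, ⟪e i, M⟫ < 0 ↔ ⟪e i, x⟫ ≤ 0) := by
  obtain ⟨m, hm⟩ := exists_comp (negNormal e) x b
  obtain ⟨M, hM⟩ := exists_comp (negNormal e) x (-b)
  simp only [negNormal_apply, inner_neg_right] at hm hM
  refine ⟨m, fun i => ?_, M, fun i => ?_, fun i => ?_, fun i => ?_⟩
  · have := hm i; have := hb i
    grind
  · have := hM i; have := hb i
    grind
  · have := hm i; have := hb i
    constructor <;> grind
  · have := hM i; have := hb i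
    constructor <;> grind

theorem isFacialInterval_closedFace {e : ι → V} {b x m M : V} (hb : ∀ i, 0 < ⟪e i, b⟫)
    (hm : m ∈ arrComplement e) (hM : M ∈ arrComplement e)
    (hmx : ∀ i, ⟪e i, m⟫ < 0 ↔ ⟪e i, x⟫ < 0) (hMx : ∀ i, ⟪e i, M⟫ < 0 ↔ ⟪e i, x⟫ ≤ 0) :
    IsFacialInterval e (closedFace e b) (closedFace e x) (closedFace e m) (closedFace e M) := by
  refine ⟨isRegion_iff.2 ⟨m, hm, rfl⟩, isRegion_iff.2 ⟨M, hM, rfl⟩, fun R hR => ?_⟩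
  obtain ⟨y, hy, rfl⟩ := isRegion_iff.1 hR
  rw [closedFace_subset_iff hy, prle_closedFace hb hm hy, prle_closedFace hb hy hM,
    ← forall_and]
  refine forall_congr' fun i => ?_
  rw [hmx, hMx]
  have hyi := hy i
  constructor
  · intro h
    constructor
    · intro hx
      exact lt_of_le_of_ne (nonpos_of_mul_nonneg_left h hx) hyi
    · intro hy
      exact nonpos_of_mul_nonneg_right h hy
  · rintro ⟨h1, h2⟩
    rcases hyi.lt_or_gt with h | h
    · exact mul_nonneg_of_nonpos_of_nonpos h.le (h2 h)
    · exact mul_nonneg h.le (not_lt.1 fun h' => (h1 h').not_gt h)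

theorem IsFacialInterval.sepSet_eq {e : ι → V} {B F m M m' M' : Set V}
    (h : IsFacialInterval e B F m M) (h' : IsFacialInterval e B F m' M')
    (hF : F ⊆ m') : sepSet e B m = sepSet e B m' ∧ sepSet e B M = sepSet e B M' := by
  have h1 := (h.2.2 _ h'.1).1 hF
  have hmM : PRle e B m M := h1.1.trans h1.2
  have h2 := (h'.2.2 _ h.1).1 ((h.2.2 _ h.1).2 ⟨subset_rfl, hmM⟩)
  have h3 := (h'.2.2 _ h.2.1).1 ((h.2.2 _ h.2.1).2 ⟨hmM, subset_rfl⟩)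
  have h4 := (h.2.2 _ h'.2.1).1 ((h'.2.2 _ h'.2.1).2 ⟨h3.1.trans h3.2, subset_rfl⟩)
  exact ⟨h1.1.antisymm h2.1, h3.2.antisymm h4.2⟩

theorem fwle_closedFace {e : ι → V} {b x y : V} (hb : ∀ i, 0 < ⟪e i, b⟫) :
    FWle e (closedFace e b) (closedFace e x) (closedFace e y) ↔ SignLE (negNormal e) x y := by
  obtain ⟨m, hm, M, hM, hmx, hMx⟩ := exists_extreme_points hb x
  obtain ⟨n, hn, N, hN, hny, hNy⟩ := exists_extreme_points hb y
  have hx := isFacialInterval_closedFace hb hm hM hmx hMx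
  have hy := isFacialInterval_closedFace hb hn hN hny hNy
  have hsign : SignLE (negNormal e) x y ↔
      PRle e (closedFace e b) (closedFace e m) (closedFace e n) ∧
      PRle e (closedFace e b) (closedFace e M) (closedFace e N) := by
    rw [prle_closedFace hb hm hn, prle_closedFace hb hM hN, ← forall_and]
    simp only [SignLE, negNormal_apply, hmx, hny, hMx, hNy, neg_pos, neg_nonneg]
  have hsub : ∀ {x m : V}, m ∈ arrComplement e → (∀ i, ⟪e i, m⟫ < 0 ↔ ⟪e i, x⟫ < 0) →
      closedFace e x ⊆ closedFace e m := by
    intro x m hm h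
    rw [closedFace_subset_iff hm]
    intro i
    rcases (hm i).lt_or_gt with h' | h'
    · exact mul_nonneg_of_nonpos_of_nonpos h'.le ((h i).1 h').le
    · exact mul_nonneg h'.le (not_lt.1 fun h'' => ((h i).2 h'').not_gt h')
  rw [hsign]
  constructor
  · rintro ⟨m', M', n', N', h1, h2, h3, h4⟩
    obtain ⟨e1, e2⟩ := h1.sepSet_eq hx (hsub hm hmx)
    obtain ⟨e3, e4⟩ := h2.sepSet_eq hy (hsub hn hny)
    simp only [PRle, e1, e2, e3, e4] at h3 h4
    exact ⟨h3, h4⟩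
  · rintro ⟨h3, h4⟩
    exact ⟨_, _, _, _, hx, hy, h3, h4⟩

theorem closedFace_eq_of_signLE {e : ι → V} {x y : V} (h : SignLE (negNormal e) x y)
    (h' : SignLE (negNormal e) y x) : closedFace e x = closedFace e y := by
  have key : ∀ {x y : V}, SignLE (negNormal e) x y → SignLE (negNormal e) y x →
      closedFace e x ⊆ closedFace e y := by
    intro x y h h' v hv i
    have h1 := h i
    have h2 := h' i
    obtain ⟨h3, h4⟩ := hv i
    simp only [negNormal_apply, neg_pos, neg_nonneg] at h1 h2
    refine ⟨fun h0 => h3 (by grind), ?_⟩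
    rcases lt_trichotomy ⟪e i, x⟫ 0 with hx | hx | hx
    · exact mul_nonneg_of_nonpos_of_nonpos (h1.1 hx).le (nonpos_of_mul_nonneg_right h4 hx)
    · simp [h3 hx]
    · have hy : 0 < ⟪e i, y⟫ := by grind
      exact mul_nonneg hy.le (nonneg_of_mul_nonneg_right h4 hx)
  exact (key h h').antisymm (key h' h)

theorem isFace_closedFace {e : ι → V} {b : V} (hb : ∀ i, 0 < ⟪e i, b⟫) (x : V) :
    IsFace e (closedFace e x) := by
  obtain ⟨m, hm, M, hM, hmx, hMx⟩ := exists_extreme_points hb x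
  refine ⟨{closedFace e m, closedFace e M}, ⟨_, Or.inl rfl⟩, ?_, ?_⟩
  · rintro R (rfl | rfl)
    · exact isRegion_iff.2 ⟨m, hm, rfl⟩
    · exact isRegion_iff.2 ⟨M, hM, rfl⟩
  · rw [Set.sInter_pair]
    ext v
    rw [Set.mem_inter_iff, mem_closedFace_of_generic hm, mem_closedFace_of_generic hM,
      ← forall_and, mem_closedFace]
    refine forall_congr' fun i => ?_
    have h1 := hmx i
    have h2 := hMx i
    have h3 := hm i
    have h4 := hM i
    rcases lt_trichotomy ⟪e i, x⟫ 0 with hx | hx | hx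
    · have hm0 := h1.2 hx
      have hM0 := h2.2 hx.le
      simp only [hx.ne, false_imp_iff, true_and, and_self,
        mul_nonneg_iff, hx.not_ge, hm0.not_ge, hM0.not_ge, hx.le, hm0.le, hM0.le, false_and,
        false_or]
    · have hm0 : 0 < ⟪e i, m⟫ := by grind
      have hM0 := h2.2 hx.le
      simp only [hx, zero_mul, le_refl, and_true, true_imp_iff, mul_nonneg_iff, hm0.le, hM0.le,
        hm0.not_ge, hM0.not_ge, true_and, false_and, or_false, false_or]
      exact ⟨fun h => ⟨h.ge, h.le⟩, fun h => le_antisymm h.2 h.1⟩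
    · have hm0 : 0 < ⟪e i, m⟫ := by grind
      have hM0 : 0 < ⟪e i, M⟫ := by grind
      simp only [hx.ne', false_imp_iff, true_and, mul_nonneg_iff_of_pos_left, hx, hm0, hM0,
        and_self]

theorem IsFace.exists_eq_closedFace {e : ι → V} {F : Set V} (hF : IsFace e F) :
    ∃ x, F = closedFace e x := by
  classical
  obtain ⟨Rs, ⟨R₀, hR₀⟩, hRs, rfl⟩ := hF
  have hmem : ∀ R ∈ Rs, ∃ y ∈ arrComplement e, R = closedFace e y := fun R hR =>
    isRegion_iff.1 (hRs R hR)
  obtain ⟨y₀, hy₀, rfl⟩ := hmem _ hR₀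
  -- for every hyperplane not containing the face, a point of the face outside it
  have hpt : ∀ i, ∃ v ∈ ⋂₀ Rs, (∃ w ∈ ⋂₀ Rs, ⟪e i, w⟫ ≠ 0) → ⟪e i, v⟫ ≠ 0 := by
    intro i
    by_cases h : ∃ w ∈ ⋂₀ Rs, ⟪e i, w⟫ ≠ 0
    · obtain ⟨w, hw, hw0⟩ := h
      exact ⟨w, hw, fun _ => hw0⟩
    · refine ⟨0, fun R hR => ?_, fun h' => absurd h' h⟩
      obtain ⟨y, hy, rfl⟩ := hmem R hR
      simp [mem_closedFace]
  choose p hpF hp using hpt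
  have hsum : ∀ y ∈ arrComplement e, closedFace e y ∈ Rs → ∀ i,
      ⟪e i, y⟫ * ⟪e i, ∑ j, p j⟫ = ∑ j, ⟪e i, y⟫ * ⟪e i, p j⟫ := fun y _ _ i => by
    rw [inner_sum, Finset.mul_sum]
  have hnonneg : ∀ y ∈ arrComplement e, closedFace e y ∈ Rs → ∀ v ∈ ⋂₀ Rs, ∀ i,
      0 ≤ ⟪e i, y⟫ * ⟪e i, v⟫ := fun y _ hyR v hv i => (hv _ hyR i).2
  have hpos : ∀ y ∈ arrComplement e, closedFace e y ∈ Rs → ∀ i, (∃ w ∈ ⋂₀ Rs, ⟪e i, w⟫ ≠ 0) →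
      0 < ⟪e i, y⟫ * ⟪e i, ∑ j, p j⟫ := by
    intro y hy hyR i hi
    rw [hsum y hy hyR]
    exact Finset.sum_pos' (fun j _ => hnonneg y hy hyR _ (hpF j) i)
      ⟨i, Finset.mem_univ _, lt_of_le_of_ne (hnonneg y hy hyR _ (hpF i) i)
        (mul_ne_zero (hy i) (hp i hi)).symm⟩
  refine ⟨∑ j, p j, Set.Subset.antisymm (fun v hv i => ?_) (fun v hv R hR => ?_)⟩
  · by_cases hi : ∃ w ∈ ⋂₀ Rs, ⟪e i, w⟫ ≠ 0
    · have h1 := hpos y₀ hy₀ hR₀ i hi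
      have h2 := hnonneg y₀ hy₀ hR₀ v hv i
      refine ⟨fun h0 => by simp [h0] at h1, ?_⟩
      by_contra! h3
      nlinarith [mul_nonneg h1.le h2, mul_self_pos.2 (hy₀ i)]
    · push Not at hi
      simp [hi v hv]
  · obtain ⟨y, hy, rfl⟩ := hmem R hR
    rw [mem_closedFace_of_generic hy]
    intro i
    obtain ⟨h1, h2⟩ := hv i
    by_cases hi : ∃ w ∈ ⋂₀ Rs, ⟪e i, w⟫ ≠ 0
    · have h3 := hpos y hy hR i hi
      by_contra! h4
      nlinarith [mul_pos_of_neg_of_neg h4 h4, mul_nonneg h3.le h2,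
        mul_self_pos.2 (right_ne_zero_of_mul h3.ne')]
    · push Not at hi
      have : ⟪e i, ∑ j, p j⟫ = 0 := by
        rw [inner_sum]
        exact Finset.sum_eq_zero fun j _ => hi _ (hpF j)
      simp [h1 this]

theorem genericJoins_of_lattice {e : ι → V} {b : V} (hb : ∀ i, 0 < ⟪e i, b⟫)
    (hlat : PRIsLattice e (closedFace e b)) : GenericJoins (negNormal e) := by
  have hgen : ∀ {x : V}, Generic (negNormal e) x ↔ x ∈ arrComplement e := by
    intro x
    simp [Generic, arrComplement, negNormal_apply]
  have hle : ∀ {x y : V}, Generic (negNormal e) x → Generic (negNormal e) y →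
      (SignLE (negNormal e) x y ↔ PRle e (closedFace e b) (closedFace e x) (closedFace e y)) := by
    intro x y hx hy
    rw [prle_closedFace hb (hgen.1 hx) (hgen.1 hy)]
    constructor
    · intro h i hi
      have := (h i).1
      simp only [negNormal_apply, neg_pos] at this
      exact this hi
    · intro h
      refine hx.signLE fun i hi => ?_
      simp only [negNormal_apply, neg_pos] at hi ⊢
      exact h i hi
  intro x y hx hy
  obtain ⟨⟨J, hJ, hxJ, hyJ, hleast⟩, -⟩ := hlat (closedFace e x) (closedFace e y)
    (isRegion_iff.2 ⟨x, hgen.1 hx, rfl⟩) (isRegion_iff.2 ⟨y, hgen.1 hy, rfl⟩)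
  obtain ⟨z, hz, rfl⟩ := isRegion_iff.1 hJ
  have hz' := hgen.2 hz
  refine ⟨z, hz', (hle hx hz').2 hxJ, (hle hy hz').2 hyJ, fun u hu hxu hyu => ?_⟩
  exact (hle hz' hu).2 (hleast _ (isRegion_iff.2 ⟨u, hgen.1 hu, rfl⟩) ((hle hx hu).1 hxu)
    ((hle hy hu).1 hyu))

theorem FWcover.signLE {e : ι → V} {b z x : V} (hb : ∀ i, 0 < ⟪e i, b⟫)
    (h : FWcover e (closedFace e b) (closedFace e z) (closedFace e x)) :
    SignLE (negNormal e) z x ∧ ¬ SignLE (negNormal e) x z ∧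
      ∀ w, SignLE (negNormal e) z w → SignLE (negNormal e) w x →
        SignLE (negNormal e) w z ∨ SignLE (negNormal e) x w := by
  obtain ⟨⟨hzx, hne⟩, hcov⟩ := h
  have hzx' := (fwle_closedFace hb).1 hzx
  refine ⟨hzx', fun h => hne (closedFace_eq_of_signLE hzx' h), fun w hzw hwx => ?_⟩
  by_contra! hcon
  refine hcov ⟨closedFace e w, isFace_closedFace hb w,
    ⟨(fwle_closedFace hb).2 hzw, fun heq => hcon.1 ?_⟩,
    ⟨(fwle_closedFace hb).2 hwx, fun heq => hcon.2 ?_⟩⟩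
  · rw [← fwle_closedFace hb, ← heq]
    exact (fwle_closedFace hb).2 fun i => ⟨id, id⟩
  · rw [← fwle_closedFace hb, ← heq]
    exact (fwle_closedFace hb).2 fun i => ⟨id, id⟩

end Translation

/-- If the poset of regions is a lattice and `X`, `Y` both cover `Z` in the facial
weak order, then `X` and `Y` have a join in the facial weak order. -/
theorem stmt14 (e : ι → V) (hne : ∀ i, e i ≠ 0) (hess : IsEssential e) (B : Set V)
    (hB : IsRegion e B) (hBpos : ∀ i, B ⊆ posHalf e i)
    (hlat : PRIsLattice e B)
    (Z X Y : Set V) (hZ : IsFace e Z) (hX : IsFace e X) (hY : IsFace e Y)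
    (hZX : FWcover e B Z X) (hZY : FWcover e B Z Y) :
    ∃ J, IsFace e J ∧ FWle e B X J ∧ FWle e B Y J ∧
      ∀ U, IsFace e U → FWle e B X U → FWle e B Y U → FWle e B J U := by
  obtain ⟨b, hb, rfl⟩ := isRegion_iff.1 hB
  have hb' : ∀ i, 0 < ⟪e i, b⟫ := fun i =>
    lt_of_le_of_ne (hBpos i (self_mem_closedFace e b)) (hb i).symm
  obtain ⟨z, rfl⟩ := hZ.exists_eq_closedFace
  obtain ⟨x, rfl⟩ := hX.exists_eq_closedFace
  obtain ⟨y, rfl⟩ := hY.exists_eq_closedFace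
  obtain ⟨hx1, hx2, hx3⟩ := hZX.signLE hb'
  obtain ⟨hy1, hy2, hy3⟩ := hZY.signLE hb'
  obtain ⟨k, hxk, hyk, hk⟩ := exists_join_of_covers (genericJoins_of_lattice hb' hlat)
    (fun i => by rw [negNormal_apply]; exact neg_neg_of_pos (hb' i)) hx1 hx2 hx3 hy1 hy2 hy3
  refine ⟨closedFace e k, isFace_closedFace hb' k, (fwle_closedFace hb').2 hxk,
    (fwle_closedFace hb').2 hyk, fun U hU hXU hYU => ?_⟩
  obtain ⟨u, rfl⟩ := hU.exists_eq_closedFace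
  exact (fwle_closedFace hb').2
    (hk u ((fwle_closedFace hb').1 hXU) ((fwle_closedFace hb').1 hYU))
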